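/- arXiv:2105.04864 — 3 statements merged into one kernel-verified Lean document; each statement's English description precedes it below -/
import Mathlib

section
/- For every subset P ⊆ ℝ², the function n ↦ px(n, P) is continuous on the interval (0, ∞). -/
open MeasureTheory Set
open scoped ENNReal

/-- `S` contains `P` (for subsets of `ℝ²`). -/
def PContains (S P : Set (ℝ × ℝ)) : Prop :=
  ∃ fX fY : ℝ → ℝ,
    (∀ x₀ x₁ : ℝ, (∃ y, (x₀, y) ∈ P) → (∃ y, (x₁, y) ∈ P) → x₁ < x₀ →
      x₀ - x₁ ≤ fX x₀ - fX x₁) ∧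
    (∀ y₀ y₁ : ℝ, (∃ x, (x, y₀) ∈ P) → (∃ x, (x, y₁) ∈ P) → y₁ < y₀ →
      y₀ - y₁ ≤ fY y₀ - fY y₁) ∧
    (∀ p ∈ P, (fX p.1, fY p.2) ∈ S)

/-- `px n P`: supremum of the planar Lebesgue measure of open `P`-free subsets of `[0,n]²`. -/
noncomputable def px (n : ℝ) (P : Set (ℝ × ℝ)) : ℝ≥0∞ :=
  sSup {m : ℝ≥0∞ | ∃ S : Set (ℝ × ℝ), IsOpen S ∧ S ⊆ Set.Icc (0, 0) (n, n) ∧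
    ¬ PContains S P ∧ m = volume S}

theorem PContains.mono {S T P : Set (ℝ × ℝ)} (hST : S ⊆ T) (h : PContains S P) :
    PContains T P := by
  obtain ⟨fX, fY, hX, hY, hS⟩ := h
  exact ⟨fX, fY, hX, hY, fun p hp => hST (hS p hp)⟩

theorem volume_le_px {n : ℝ} {P S : Set (ℝ × ℝ)} (hS : IsOpen S)
    (hSn : S ⊆ Set.Icc (0, 0) (n, n)) (hSP : ¬ PContains S P) : volume S ≤ px n P :=
  le_sSup ⟨S, hS, hSn, hSP, rfl⟩

theorem px_mono (P : Set (ℝ × ℝ)) : Monotone fun n => px n P := by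
  refine fun a b hab => sSup_le ?_
  rintro _ ⟨S, hS, hSa, hSP, rfl⟩
  exact volume_le_px hS (hSa.trans (Icc_subset_Icc_right ⟨hab, hab⟩)) hSP

theorem volume_Icc_sdiff_Ioo_prod {a b : ℝ} (ha : 0 ≤ a) (hab : a ≤ b) :
    volume (Set.Icc ((0 : ℝ), (0 : ℝ)) (b, b) \ Ioo 0 a ×ˢ Ioo 0 a) =
      ENNReal.ofReal (b ^ 2 - a ^ 2) := by
  have hQ : volume (Ioo 0 a ×ˢ Ioo 0 a) = ENNReal.ofReal (a ^ 2) := by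
    rw [Measure.volume_eq_prod, Measure.prod_prod, Real.volume_Ioo, sub_zero,
      ← ENNReal.ofReal_mul ha, sq]
  have hB : volume (Set.Icc ((0 : ℝ), (0 : ℝ)) (b, b)) = ENNReal.ofReal (b ^ 2) := by
    rw [← Icc_prod_Icc, Measure.volume_eq_prod, Measure.prod_prod, Real.volume_Icc, sub_zero,
      ← ENNReal.ofReal_mul (ha.trans hab), sq]
  have hsub : Ioo 0 a ×ˢ Ioo 0 a ⊆ Set.Icc ((0 : ℝ), (0 : ℝ)) (b, b) := by
    rw [← Icc_prod_Icc]
    have h : Ioo 0 a ⊆ Icc 0 b := Ioo_subset_Icc_self.trans (Icc_subset_Icc_right hab)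
    exact prod_mono h h
  rw [measure_sdiff hsub (measurableSet_Ioo.prod measurableSet_Ioo).nullMeasurableSet
    (hQ ▸ ENNReal.ofReal_ne_top), hQ, hB, ENNReal.ofReal_sub _ (sq_nonneg a)]

theorem px_le_px_add {a b : ℝ} (P : Set (ℝ × ℝ)) (ha : 0 ≤ a) (hab : a ≤ b) :
    px b P ≤ px a P + ENNReal.ofReal (b ^ 2 - a ^ 2) := by
  refine sSup_le ?_
  rintro _ ⟨S, hS, hSb, hSP, rfl⟩
  calc
    volume S ≤ volume (S ∩ Ioo 0 a ×ˢ Ioo 0 a) + volume (S \ Ioo 0 a ×ˢ Ioo 0 a) :=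
      measure_le_inter_add_sdiff _ _ _
    _ ≤ px a P + ENNReal.ofReal (b ^ 2 - a ^ 2) := by
      gcongr
      · refine volume_le_px (hS.inter (isOpen_Ioo.prod isOpen_Ioo)) ?_
          fun h => hSP (h.mono inter_subset_left)
        rw [← Icc_prod_Icc]
        exact inter_subset_right.trans (prod_mono Ioo_subset_Icc_self Ioo_subset_Icc_self)
      · rw [← volume_Icc_sdiff_Ioo_prod ha hab]
        exact measure_mono (sdiff_subset_sdiff_left hSb)

theorem px_le_px_add_abs {a b : ℝ} (P : Set (ℝ × ℝ)) (ha : 0 ≤ a) :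
    px b P ≤ px a P + ENNReal.ofReal |b ^ 2 - a ^ 2| := by
  rcases le_total a b with hab | hba
  · exact (px_le_px_add P ha hab).trans (by gcongr; exact le_abs_self _)
  · exact (px_mono P hba).trans le_self_add

theorem px_continuousOn (P : Set (ℝ × ℝ)) :
    ContinuousOn (fun n => px n P) (Set.Ioi (0 : ℝ)) := by
  intro x hx
  have hε : Filter.Tendsto (fun n : ℝ => ENNReal.ofReal |n ^ 2 - x ^ 2|)
      (nhdsWithin x (Set.Ioi 0)) (nhds 0) := by
    have h : Continuous fun n : ℝ => ENNReal.ofReal |n ^ 2 - x ^ 2| :=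
      ENNReal.continuous_ofReal.comp (by fun_prop)
    simpa using (h.tendsto x).mono_left nhdsWithin_le_nhds
  have hlower : Filter.Tendsto (fun n : ℝ => px x P - ENNReal.ofReal |n ^ 2 - x ^ 2|)
      (nhdsWithin x (Set.Ioi 0)) (nhds (px x P)) := by
    simpa using ENNReal.Tendsto.sub tendsto_const_nhds hε (Or.inr ENNReal.zero_ne_top)
  have hupper : Filter.Tendsto (fun n : ℝ => px x P + ENNReal.ofReal |n ^ 2 - x ^ 2|)
      (nhdsWithin x (Set.Ioi 0)) (nhds (px x P)) := by
    simpa using tendsto_const_nhds.add hε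
  refine tendsto_of_tendsto_of_tendsto_of_le_of_le' hlower hupper ?_ ?_
  · filter_upwards [self_mem_nhdsWithin] with n hn
    rw [tsub_le_iff_right, abs_sub_comm]
    exact px_le_px_add_abs P (le_of_lt hn)
  · exact Filter.Eventually.of_forall fun n => px_le_px_add_abs P (le_of_lt hx)
end

section
/- For every nonempty finite subset P ⊆ ℝ² there exists a constant C > 0 (depending on P) such that px(n, P) ≤ C · ex(n, M_P) for every positive integer n. -/
open MeasureTheory Set
open scoped ENNReal

/-- A 0-1 matrix `A` contains a 0-1 matrix `M`. -/
def MContains {n₁ n₂ a b : ℕ} (A : Fin n₁ → Fin n₂ → Prop) (M : Fin a → Fin b → Prop) : Prop :=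
  ∃ r : Fin a → Fin n₁, ∃ c : Fin b → Fin n₂, StrictMono r ∧ StrictMono c ∧
    ∀ i j, M i j → A (r i) (c j)

/-- `mEx n M`: the maximum number of ones in an `n × n` 0-1 matrix avoiding `M`. -/
noncomputable def mEx (n : ℕ) {a b : ℕ} (M : Fin a → Fin b → Prop) : ℕ :=
  sSup {k : ℕ | ∃ A : Fin n → Fin n → Prop, ¬ MContains A M ∧
    k = {p : Fin n × Fin n | A p.1 p.2}.ncard}

/-- A pairwise bound for the differences of a finite family of reals, larger than `1`. -/
lemma exists_one_lt_bound_sub {ι : Type*} [Finite ι] (x : ι → ℝ) :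
    ∃ K : ℝ, 1 < K ∧ ∀ i j, x i - x j ≤ K := by
  obtain ⟨K, hK⟩ := (Set.finite_range fun p : ι × ι => x p.1 - x p.2).bddAbove
  refine ⟨max K 2, by simp, fun i j => le_max_of_le_left ?_⟩
  exact hK ⟨(i, j), rfl⟩

/-- Stretching a strictly increasing map into `Fin n` by `K` dominates all gaps of size at most
`K`. -/
lemma sub_le_mul_sub_of_strictMono {b n : ℕ} {x : Fin b → ℝ} (hx : StrictMono x)
    {c : Fin b → Fin n} (hc : StrictMono c) {K : ℝ} (hK : 0 ≤ K)
    (hxK : ∀ i j, x i - x j ≤ K) (t : ℝ) {i j : Fin b} (h : x j < x i) :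
    x i - x j ≤ (K * (c i : ℕ) + t) - (K * (c j : ℕ) + t) := by
  have h1 : (c j : ℕ) + 1 ≤ c i := hc (hx.lt_iff_lt.1 h)
  have h2 : ((c j : ℕ) : ℝ) + 1 ≤ (c i : ℕ) := by exact_mod_cast h1
  nlinarith [hxK i j]

/-- If the matrix obtained by sampling `S` on a translated grid of mesh `K` contains the pattern
of `P`, then `S` contains `P`. -/
lemma pContains_of_mContains_grid {S P : Set (ℝ × ℝ)} {a b n : ℕ} {x : Fin b → ℝ} {y : Fin a → ℝ}
    (hx : StrictMono x) (hy : StrictMono y)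
    (hxr : Set.range x = Prod.fst '' P) (hyr : Set.range y = Prod.snd '' P)
    {K : ℝ} (hK : 0 ≤ K) (hxK : ∀ i j, x i - x j ≤ K) (hyK : ∀ i j, y i - y j ≤ K)
    (t : ℝ × ℝ)
    (h : MContains
      (fun i j : Fin n => (K * (j : ℕ) + t.1, K * ((Fin.rev i : Fin n) : ℕ) + t.2) ∈ S)
      (fun i j => (x j, y (Fin.rev i)) ∈ P)) :
    PContains S P := by
  obtain ⟨r, c, hr, hc, hA⟩ := h
  have hr' : StrictMono fun k => Fin.rev (r (Fin.rev k)) := fun k l hkl =>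
    Fin.rev_lt_rev.2 (hr (Fin.rev_lt_rev.2 hkl))
  have hxP : ∀ {u v}, (u, v) ∈ P → ∃ j, x j = u := fun {u v} h =>
    (hxr.symm ▸ mem_image_of_mem Prod.fst h : u ∈ Set.range x)
  have hyP : ∀ {u v}, (u, v) ∈ P → ∃ j, y j = v := fun {u v} h =>
    (hyr.symm ▸ mem_image_of_mem Prod.snd h : v ∈ Set.range y)
  refine ⟨Function.extend x (fun j => K * (c j : ℕ) + t.1) 0,
    Function.extend y (fun k => K * ((Fin.rev (r (Fin.rev k)) : Fin n) : ℕ) + t.2) 0, ?_, ?_, ?_⟩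
  · rintro _ _ ⟨_, h₀⟩ ⟨_, h₁⟩ hlt
    obtain ⟨i, rfl⟩ := hxP h₀
    obtain ⟨j, rfl⟩ := hxP h₁
    rw [hx.injective.extend_apply, hx.injective.extend_apply]
    exact sub_le_mul_sub_of_strictMono hx hc hK hxK t.1 hlt
  · rintro _ _ ⟨_, h₀⟩ ⟨_, h₁⟩ hlt
    obtain ⟨i, rfl⟩ := hyP h₀
    obtain ⟨j, rfl⟩ := hyP h₁
    rw [hy.injective.extend_apply, hy.injective.extend_apply]
    exact sub_le_mul_sub_of_strictMono hy hr' hK hyK t.2 hlt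
  · rintro ⟨u, v⟩ hp
    obtain ⟨j, rfl⟩ := hxP hp
    obtain ⟨k, rfl⟩ := hyP hp
    simp only [hx.injective.extend_apply, hy.injective.extend_apply]
    exact hA (Fin.rev k) j (by simpa using hp)

/-- The number of ones of an avoiding matrix is at most `mEx`. -/
lemma ncard_le_mEx {n a b : ℕ} {M : Fin a → Fin b → Prop} {A : Fin n → Fin n → Prop}
    (h : ¬ MContains A M) : {p : Fin n × Fin n | A p.1 p.2}.ncard ≤ mEx n M := by
  refine le_csSup ⟨Nat.card (Fin n × Fin n), ?_⟩ ⟨A, h, rfl⟩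
  rintro k ⟨B, -, rfl⟩
  exact Set.ncard_le_card _

/-- Every point of `[0, n]` lies in one of the first `n` half-open intervals of length `K > 1`. -/
lemma exists_fin_sub_mem_Ico {n : ℕ} (hn : 0 < n) {K : ℝ} (hK : 1 < K) {s : ℝ}
    (h0 : 0 ≤ s) (hs : s ≤ n) : ∃ i : Fin n, s - K * (i : ℕ) ∈ Set.Ico 0 K := by
  have hK0 : 0 < K := by linarith
  have hn' : (0 : ℝ) < n := by exact_mod_cast hn
  have hlt : ⌊s / K⌋₊ < n := by
    rw [Nat.floor_lt (by positivity), div_lt_iff₀ hK0]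
    nlinarith
  refine ⟨⟨_, hlt⟩, ?_, ?_⟩
  · have := (le_div_iff₀ hK0).1 (Nat.floor_le (div_nonneg h0 hK0.le))
    dsimp only
    linarith
  · have := (div_lt_iff₀ hK0).1 (Nat.lt_floor_add_one (s / K))
    dsimp only
    linarith

/-- If every translate by `t ∈ T` of a finite family of points `v` meets `S` at most `m` times, and
the translates of `T` by `v` cover `S`, then `S` has measure at most `m` times that of `T`. -/
lemma volume_le_of_ncard_translate_le {ι : Type*} [Fintype ι] {S T : Set (ℝ × ℝ)}
    (hS : MeasurableSet S) (hT : MeasurableSet T) (v : ι → ℝ × ℝ)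
    (hcov : ∀ s ∈ S, ∃ p, s - v p ∈ T) (m : ℕ)
    (hm : ∀ t ∈ T, {p | v p + t ∈ S}.ncard ≤ m) :
    volume S ≤ m * volume T := by
  classical
  have hmeas : ∀ p, MeasurableSet ((fun t => v p + t) ⁻¹' S) := fun p =>
    hS.preimage (measurable_const_add _)
  calc volume S
      ≤ volume (⋃ p, (fun s => -v p + s) ⁻¹' ((fun t => v p + t) ⁻¹' S ∩ T)) := by
        refine measure_mono fun s hs => ?_
        obtain ⟨p, hp⟩ := hcov s hs
        refine mem_iUnion.2 ⟨p, ?_, ?_⟩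
        · simpa using hs
        · simpa [neg_add_eq_sub] using hp
    _ ≤ ∑ p, volume ((fun s => -v p + s) ⁻¹' ((fun t => v p + t) ⁻¹' S ∩ T)) :=
        measure_iUnion_fintype_le _ _
    _ = ∑ p, ∫⁻ t in T, ((fun t => v p + t) ⁻¹' S).indicator 1 t := by
        refine Finset.sum_congr rfl fun p _ => ?_
        rw [measure_preimage_add, lintegral_indicator_one (hmeas p),
          Measure.restrict_apply (hmeas p)]
    _ = ∫⁻ t in T, ∑ p, ((fun t => v p + t) ⁻¹' S).indicator 1 t :=
        (lintegral_finsetSum _ fun p _ => measurable_one.indicator (hmeas p)).symm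
    _ ≤ ∫⁻ _ in T, (m : ℝ≥0∞) := by
        refine setLIntegral_mono' hT fun t ht => ?_
        have h : ∑ p, ((fun t => v p + t) ⁻¹' S).indicator (1 : ℝ × ℝ → ℝ≥0∞) t
            = ({p | v p + t ∈ S}.ncard : ℝ≥0∞) := by
          simp [Set.indicator_apply, Set.ncard_eq_toFinset_card']
        rw [h]
        exact_mod_cast hm t ht
    _ = m * volume T := setLIntegral_const _ _

theorem px_upper_bound_mEx (P : Set (ℝ × ℝ)) (hPfin : P.Finite) (hPne : P.Nonempty)
    (a b : ℕ) (x : Fin b → ℝ) (y : Fin a → ℝ) (hx : StrictMono x) (hy : StrictMono y)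
    (hxr : Set.range x = Prod.fst '' P) (hyr : Set.range y = Prod.snd '' P) :
    ∃ C : ℝ, 0 < C ∧ ∀ n : ℕ, 0 < n →
      px (n : ℝ) P ≤
        ENNReal.ofReal (C * (mEx n (fun i j => (x j, y (Fin.rev i)) ∈ P) : ℝ)) := by
  obtain ⟨K₁, hK₁, hxK₁⟩ := exists_one_lt_bound_sub x
  obtain ⟨K₂, -, hyK₂⟩ := exists_one_lt_bound_sub y
  set K := max K₁ K₂
  have hK : 1 < K := lt_max_of_lt_left hK₁
  have hxK : ∀ i j, x i - x j ≤ K := fun i j => (hxK₁ i j).trans (le_max_left _ _)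
  have hyK : ∀ i j, y i - y j ≤ K := fun i j => (hyK₂ i j).trans (le_max_right _ _)
  have hK0 : 0 < K := by linarith
  refine ⟨K * K, by positivity, fun n hn => sSup_le ?_⟩
  rintro _ ⟨S, hSo, hSn, hSP, rfl⟩
  set m := mEx n (fun i j => (x j, y (Fin.rev i)) ∈ P)
  have key : volume S ≤ m * volume (Set.Ico 0 K ×ˢ Set.Ico 0 K) := by
    refine volume_le_of_ncard_translate_le hSo.measurableSet
      (measurableSet_Ico.prod measurableSet_Ico)
      (fun p : Fin n × Fin n => (K * (p.2 : ℕ), K * ((Fin.rev p.1 : Fin n) : ℕ)))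
      (fun s hs => ?_) m fun t _ => ?_
    · obtain ⟨⟨h1, h2⟩, h3, h4⟩ := hSn hs
      obtain ⟨j, hj⟩ := exists_fin_sub_mem_Ico hn hK h1 h3
      obtain ⟨i, hi⟩ := exists_fin_sub_mem_Ico hn hK h2 h4
      exact ⟨(Fin.rev i, j), hj, by simpa only [Fin.rev_rev, Prod.snd_sub] using hi⟩
    · exact ncard_le_mEx fun h =>
        hSP (pContains_of_mContains_grid hx hy hxr hyr hK0.le hxK hyK t h)
  refine key.trans_eq ?_
  rw [Measure.volume_eq_prod, Measure.prod_prod, Real.volume_Ico, sub_zero,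
    ← ENNReal.ofReal_mul hK0.le, mul_comm, ENNReal.ofReal_mul (by positivity : 0 ≤ K * K),
    ENNReal.ofReal_natCast]
end

section
/- Let c and n be real numbers with 0 < c ≤ n, and let P = [0, c] × {0} (a closed horizontal segment of length c). Then px(n, P) = c·n. -/
open MeasureTheory Set
open scoped ENNReal

/-- The measure of the part of a set of finite measure lying to the left of a point is a
`1`-Lipschitz function of the point. -/
theorem lipschitzWith_measureReal_inter_Iic {K : Set ℝ} (hK : volume K ≠ ∞) :
    LipschitzWith 1 fun x : ℝ => volume.real (K ∩ Iic x) := by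
  refine LipschitzWith.of_le_add fun x y => ?_
  have hfin : volume ((K ∩ Iic y) ∪ Ioc y x) ≠ ∞ :=
    (measure_union_lt_top (measure_inter_lt_top_of_left_ne_top hK) measure_Ioc_lt_top).ne
  have hsub : K ∩ Iic x ⊆ (K ∩ Iic y) ∪ Ioc y x := by
    rintro z ⟨hz, hzx⟩
    rcases le_or_gt z y with h | h
    · exact Or.inl ⟨hz, h⟩
    · exact Or.inr ⟨h, hzx⟩
  calc volume.real (K ∩ Iic x) ≤ volume.real ((K ∩ Iic y) ∪ Ioc y x) := measureReal_mono hsub hfin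
    _ ≤ volume.real (K ∩ Iic y) + volume.real (Ioc y x) := measureReal_union_le _ _
    _ ≤ volume.real (K ∩ Iic y) + dist x y := by
      gcongr
      rw [Measure.real, Real.volume_Ioc, ENNReal.toReal_ofReal', Real.dist_eq]
      exact max_le (le_abs_self _) (abs_nonneg _)

/-- In a nonempty compact set of reals, every value between `0` and its measure is the measure of
the part of the set lying to the left of one of its points. -/
theorem IsCompact.exists_mem_measureReal_inter_Iic_eq {K : Set ℝ} (hK : IsCompact K)
    (hne : K.Nonempty) {t : ℝ} (ht : t ∈ Icc 0 (volume.real K)) :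
    ∃ s ∈ K, volume.real (K ∩ Iic s) = t := by
  obtain ⟨a, haK, ha⟩ := hK.exists_isLeast hne
  obtain ⟨b, hbK, hb⟩ := hK.exists_isGreatest hne
  have hga : volume.real (K ∩ Iic a) = 0 := by
    have hsub : K ∩ Iic a ⊆ {a} := fun z hz => le_antisymm hz.2 (ha hz.1)
    rw [Measure.real, measure_mono_null hsub (by simp), ENNReal.toReal_zero]
  have hgb : K ∩ Iic b = K := inter_eq_left.2 fun z hz => hb hz
  obtain ⟨x, hx, rfl⟩ := intermediate_value_Icc (ha hbK)
    (lipschitzWith_measureReal_inter_Iic hK.measure_lt_top.ne).continuous.continuousOn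
    (show t ∈ Icc (volume.real (K ∩ Iic a)) (volume.real (K ∩ Iic b)) by rwa [hga, hgb])
  obtain ⟨s, ⟨hsK, hsx⟩, hs⟩ := (hK.inter_right isClosed_Iic).exists_isGreatest ⟨a, haK, hx.1⟩
  refine ⟨s, hsK, ?_⟩
  have heq : K ∩ Iic s = K ∩ Iic x := Subset.antisymm
    (inter_subset_inter_right K (Iic_subset_Iic.2 hsx)) (fun z hz => ⟨hz.1, hs hz⟩)
  simp only [heq]

/-- An open set of reals of measure greater than `c` contains the image of `[0, c]` under a map
that preserves the order and does not decrease distances. -/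
theorem exists_expanding_map_of_lt_volume {U : Set ℝ} (hU : IsOpen U) {c : ℝ}
    (hcU : ENNReal.ofReal c < volume U) :
    ∃ f : ℝ → ℝ, (∀ t ∈ Icc 0 c, f t ∈ U) ∧
      ∀ t₀ ∈ Icc 0 c, ∀ t₁ ∈ Icc 0 c, t₁ < t₀ → t₀ - t₁ ≤ f t₀ - f t₁ := by
  obtain ⟨K, hKU, hK, hcK⟩ := hU.exists_lt_isCompact hcU
  have hne : K.Nonempty := nonempty_of_measure_ne_zero (ne_bot_of_gt hcK)
  have hc : c ≤ volume.real K :=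
    (ENNReal.ofReal_le_iff_le_toReal hK.measure_lt_top.ne).1 hcK.le
  have hex (t : ℝ) : ∃ s, t ∈ Icc 0 c → s ∈ K ∧ volume.real (K ∩ Iic s) = t := by
    by_cases ht : t ∈ Icc 0 c
    · obtain ⟨s, hs⟩ := hK.exists_mem_measureReal_inter_Iic_eq hne ⟨ht.1, ht.2.trans hc⟩
      exact ⟨s, fun _ => hs⟩
    · exact ⟨0, fun h => absurd h ht⟩
  choose f hf using hex
  refine ⟨f, fun t ht => hKU (hf t ht).1, fun t₀ h₀ t₁ h₁ hlt => ?_⟩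
  have e₀ := (hf t₀ h₀).2
  have e₁ := (hf t₁ h₁).2
  have hle : f t₁ ≤ f t₀ := by
    by_contra! h
    have hmono : volume.real (K ∩ Iic (f t₀)) ≤ volume.real (K ∩ Iic (f t₁)) :=
      measureReal_mono (inter_subset_inter_right _ (Iic_subset_Iic.2 h.le))
        (measure_inter_lt_top_of_left_ne_top hK.measure_lt_top.ne).ne
    linarith
  have hdist := (lipschitzWith_measureReal_inter_Iic hK.measure_lt_top.ne).dist_le_mul
    (f t₀) (f t₁)
  simp only [e₀, e₁, NNReal.coe_one, one_mul, Real.dist_eq] at hdist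
  rwa [abs_of_pos (sub_pos.2 hlt), abs_of_nonneg (sub_nonneg.2 hle)] at hdist

/-- Every horizontal slice of an open set avoiding a segment of length `c` has measure at most
`c`. -/
theorem volume_slice_le_of_not_pContains {S : Set (ℝ × ℝ)} (hS : IsOpen S) {c : ℝ}
    (hfree : ¬ PContains S (Icc (0 : ℝ) c ×ˢ ({0} : Set ℝ))) (y : ℝ) :
    volume ((fun x => (x, y)) ⁻¹' S) ≤ ENNReal.ofReal c := by
  by_contra! h
  obtain ⟨f, hfS, hf⟩ := exists_expanding_map_of_lt_volume (hS.preimage (by fun_prop)) h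
  refine hfree ⟨f, fun _ => y, ?_, ?_, fun p hp => hfS p.1 hp.1⟩
  · rintro x₀ x₁ ⟨_, h₀⟩ ⟨_, h₁⟩ hlt
    exact hf x₀ h₀.1 x₁ h₁.1 hlt
  · rintro y₀ y₁ ⟨_, _, h₀⟩ ⟨_, _, h₁⟩ hlt
    rw [mem_singleton_iff] at h₀ h₁
    dsimp only at h₀ h₁
    linarith

/-- An open subset of `[0, n]²` avoiding a horizontal segment of length `c` has measure at most
`c * n`. -/
theorem volume_le_of_not_pContains_segment {S : Set (ℝ × ℝ)} (hS : IsOpen S) {c n : ℝ}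
    (hc : 0 ≤ c) (hSn : S ⊆ Icc (0, 0) (n, n))
    (hfree : ¬ PContains S (Icc (0 : ℝ) c ×ˢ ({0} : Set ℝ))) :
    volume S ≤ ENNReal.ofReal (c * n) := by
  rw [Measure.volume_eq_prod, Measure.prod_apply_symm hS.measurableSet]
  calc ∫⁻ y, volume ((fun x => (x, y)) ⁻¹' S)
      ≤ ∫⁻ y, (Icc 0 n).indicator (fun _ => ENNReal.ofReal c) y := by
        refine lintegral_mono fun y => ?_
        by_cases hy : y ∈ Icc 0 n
        · rw [indicator_of_mem hy]
          exact volume_slice_le_of_not_pContains hS hfree y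
        · have hempty : (fun x => (x, y)) ⁻¹' S = ∅ :=
            eq_empty_of_forall_notMem fun x hx => hy ⟨(hSn hx).1.2, (hSn hx).2.2⟩
          simp [hempty]
    _ = ENNReal.ofReal (c * n) := by
        rw [lintegral_indicator_const measurableSet_Icc, Real.volume_Icc, sub_zero,
          ENNReal.ofReal_mul hc]

/-- A vertical strip of width `c` without its boundary avoids a horizontal segment of length
`c`. -/
theorem not_pContains_Ioo_prod {c : ℝ} (hc : 0 < c) (V : Set ℝ) :
    ¬ PContains (Ioo 0 c ×ˢ V) (Icc (0 : ℝ) c ×ˢ ({0} : Set ℝ)) := by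
  rintro ⟨f, _, hf, _, hmem⟩
  have hleft : ((0 : ℝ), (0 : ℝ)) ∈ Icc (0 : ℝ) c ×ˢ ({0} : Set ℝ) := ⟨⟨le_rfl, hc.le⟩, rfl⟩
  have hright : (c, (0 : ℝ)) ∈ Icc (0 : ℝ) c ×ˢ ({0} : Set ℝ) := ⟨⟨hc.le, le_rfl⟩, rfl⟩
  have hexp := hf c 0 ⟨0, hright⟩ ⟨0, hleft⟩ hc
  have hpos : 0 < f 0 := (hmem _ hleft).1.1
  have hlt : f c < c := (hmem _ hright).1.2
  linarith

theorem px_horizontal_segment (c n : ℝ) (hc : 0 < c) (hcn : c ≤ n) :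
    px n (Set.Icc (0 : ℝ) c ×ˢ ({0} : Set ℝ)) = ENNReal.ofReal (c * n) := by
  refine le_antisymm (sSup_le ?_) (le_sSup ?_)
  · rintro _ ⟨S, hS, hSn, hfree, rfl⟩
    exact volume_le_of_not_pContains_segment hS hc.le hSn hfree
  · refine ⟨Ioo 0 c ×ˢ Ioo 0 n, isOpen_Ioo.prod isOpen_Ioo, ?_, not_pContains_Ioo_prod hc _, ?_⟩
    · rintro ⟨x, y⟩ ⟨hx, hy⟩
      exact ⟨⟨hx.1.le, hy.1.le⟩, ⟨hx.2.le.trans hcn, hy.2.le⟩⟩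
    · rw [Measure.volume_eq_prod, Measure.prod_prod, Real.volume_Ioo, Real.volume_Ioo, sub_zero,
        sub_zero, ENNReal.ofReal_mul hc.le]
end
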